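/- Let R be a right artinian ring, P an indecomposable projective right R-module with simple socle that is not injective, I an injective hull of P, S a simple submodule of I/P, and U the pullback of S → I/P along I → I/P. Then U is finitely generated, indecomposable with simple socle, S and U are non-projective, and in the Igusa–Todorov group K one has [Ω(S)] = [Ω(U)], hence Ω⟨U ⊕ S⟩ = Ω⟨S⟩. -/

import Mathlib

open Module Function

universe u

variable (R : Type u) [Ring R]

/-- A finitely generated right `R`-module, encoded as a module over `Rᵐᵒᵖ`. -/
structure FGMod where
  carrier : Type u
  [isAddCommGroup : AddCommGroup carrier]
  [isModule : Module Rᵐᵒᵖ carrier]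
  [isFinite : Module.Finite Rᵐᵒᵖ carrier]

attribute [instance] FGMod.isAddCommGroup FGMod.isModule FGMod.isFinite

instance : CoeSort (FGMod R) (Type u) := ⟨FGMod.carrier⟩

variable {R}

/-- Isomorphism of f.g. right modules. -/
def FGMod.Iso (M N : FGMod R) : Prop := Nonempty (M ≃ₗ[Rᵐᵒᵖ] N)

/-- Direct sum. -/
def FGMod.prod (M N : FGMod R) : FGMod R := ⟨M × N⟩

/-- `M^k`, the direct sum of `k` copies of `M`. -/
def FGMod.pow (M : FGMod R) (k : ℕ) : FGMod R := ⟨Fin k → M⟩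

/-- `N` is (isomorphic to) a direct summand of `M`. -/
def FGMod.IsSummand (N M : FGMod R) : Prop :=
  ∃ A B : Submodule Rᵐᵒᵖ M, IsCompl A B ∧ Nonempty (N ≃ₗ[Rᵐᵒᵖ] A)

/-- `M` is indecomposable. -/
def FGMod.Indec (M : FGMod R) : Prop :=
  Nontrivial M ∧ ∀ A B : Submodule Rᵐᵒᵖ M, IsCompl A B → A = ⊥ ∨ B = ⊥

/-- `M` is projective. -/
def FGMod.Proj (M : FGMod R) : Prop := Module.Projective Rᵐᵒᵖ M

/-- `f : P → M` is a projective cover: `P` projective, `f` surjective with superfluous kernel. -/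
def IsProjCover (M P : FGMod R) (f : P →ₗ[Rᵐᵒᵖ] M) : Prop :=
  P.Proj ∧ Surjective f ∧ ∀ N : Submodule Rᵐᵒᵖ P, N ⊔ LinearMap.ker f = ⊤ → N = ⊤

/-- `N` is a (first) syzygy of `M`: the kernel of a projective cover of `M`. -/
def IsSyzygy (M N : FGMod R) : Prop :=
  ∃ (P : FGMod R) (f : P →ₗ[Rᵐᵒᵖ] M),
    IsProjCover M P f ∧ Nonempty (N ≃ₗ[Rᵐᵒᵖ] LinearMap.ker f)

/-- `N` is an `n`-th syzygy of `M`. -/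
def IsSyzygyN : ℕ → FGMod R → FGMod R → Prop
  | 0, M, N => M.Iso N
  | n+1, M, N => ∃ L, IsSyzygy M L ∧ IsSyzygyN n L N

/-- `M` has projective dimension at most `n`. -/
def HasPdLE : ℕ → FGMod R → Prop
  | 0, M => M.Proj
  | n+1, M => M.Proj ∨ ∃ N, IsSyzygy M N ∧ HasPdLE n N

/-- `M` has finite projective dimension. -/
def FinPd (M : FGMod R) : Prop := ∃ n, HasPdLE n M

/-- The projective dimension of `M` (junk value if infinite). -/
noncomputable def pdIT (M : FGMod R) : ℕ := sInf {n | HasPdLE n M}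

variable (R)

/-- The Igusa–Todorov relations in the free abelian group on f.g. right modules:
`[A] - [B] - [C]` whenever `A ≅ B ⊕ C`, and `[P]` for `P` projective. -/
def ITRel : Set (FreeAbelianGroup (FGMod R)) :=
  {x | ∃ A B C : FGMod R, Nonempty (A ≃ₗ[Rᵐᵒᵖ] (B × C : Type u)) ∧
        x = FreeAbelianGroup.of A - FreeAbelianGroup.of B - FreeAbelianGroup.of C} ∪
  {x | ∃ P : FGMod R, P.Proj ∧ x = FreeAbelianGroup.of P}

/-- The Igusa–Todorov group `K`. -/
def ITK := FreeAbelianGroup (FGMod R) ⧸ AddSubgroup.closure (ITRel R)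

noncomputable instance : AddCommGroup (ITK R) :=
  QuotientAddGroup.Quotient.addCommGroup _

/-- The class `[M]` in `K`. -/
noncomputable def ITcls (M : FGMod R) : ITK R := QuotientAddGroup.mk (FreeAbelianGroup.of M)

/-- `⟨M⟩`: the subgroup of `K` generated by the indecomposable non-projective
direct summands of `M`. -/
noncomputable def ITgen (M : FGMod R) : AddSubgroup (ITK R) :=
  AddSubgroup.closure
    {x | ∃ N : FGMod R, N.IsSummand M ∧ N.Indec ∧ ¬N.Proj ∧ x = ITcls R N}

/-- The rank of a subgroup of `K`. -/
noncomputable def rkIT (H : AddSubgroup (ITK R)) : ℕ :=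
  Module.finrank ℤ (AddSubgroup.toIntSubmodule H)

/-- `OmK` is a syzygy endomorphism of `K`: a group endomorphism sending `[M]` to `[ΩM]`. -/
def IsSyzygyEnd (OmK : AddMonoid.End (ITK R)) : Prop :=
  ∀ M N : FGMod R, IsSyzygy M N → OmK (ITcls R M) = ITcls R N

/-- The Igusa–Todorov function `φ`: the least `n` such that the rank of
`Ω^i⟨M⟩` equals that of `Ω^n⟨M⟩` for all `i ≥ n`. -/
noncomputable def phiIT (OmK : AddMonoid.End (ITK R)) (M : FGMod R) : ℕ :=
  sInf {n | ∀ i, n ≤ i →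
    rkIT R ((ITgen R M).map ((OmK ^ i : AddMonoid.End (ITK R)) : ITK R →+ ITK R))
      = rkIT R ((ITgen R M).map ((OmK ^ n : AddMonoid.End (ITK R)) : ITK R →+ ITK R))}

/-- The second Igusa–Todorov function `ψ`. -/
noncomputable def psiIT (OmK : AddMonoid.End (ITK R)) (M : FGMod R) : ℕ :=
  phiIT R OmK M + sSup {d | ∃ N X : FGMod R, IsSyzygyN (phiIT R OmK M) M N ∧
      X.IsSummand N ∧ FinPd X ∧ d = pdIT X}

/-- The socle of a module: the sum of its simple submodules. -/
def socleIT (M : FGMod R) : Submodule Rᵐᵒᵖ M :=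
  sSup {S : Submodule Rᵐᵒᵖ M | IsSimpleModule Rᵐᵒᵖ S}



section Aux

/-- A split surjection decomposes its source. -/
def splitEquivAux {A M N : Type*} [Ring A] [AddCommGroup M] [Module A M] [AddCommGroup N]
    [Module A N] (g : M →ₗ[A] N) (s : N →ₗ[A] M) (h : ∀ x, g (s x) = x) :
    M ≃ₗ[A] (LinearMap.ker g × N) where
  toFun x := (⟨x - s (g x), by simp [h]⟩, g x)
  invFun y := y.1.1 + s y.2
  map_add' x y := by
    ext
    · simp; abel
    · simp
  map_smul' c x := by
    ext
    · simp [smul_sub]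
    · simp
  left_inv x := by simp
  right_inv y := by
    obtain ⟨⟨k, hk⟩, n⟩ := y
    have hk' : g k = 0 := hk
    ext <;> simp [h, hk']

theorem fitting_aux {A M : Type*} [Ring A] [AddCommGroup M] [Module A M] [IsArtinian A M]
    [IsNoetherian A M]
    (hM : ∀ X Y : Submodule A M, IsCompl X Y → X = ⊥ ∨ Y = ⊥) (f : Module.End A M) :
    IsUnit f ∨ IsNilpotent f := by
  obtain ⟨n, hn, hn1⟩ := (f.eventually_isCompl_ker_pow_range_pow.and
    (Filter.eventually_ge_atTop 1)).exists
  rcases hM _ _ hn with h | h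
  · left
    have hinj : Function.Injective (f ^ n) := LinearMap.ker_eq_bot.1 h
    have hb := IsArtinian.bijective_of_injective_endomorphism _ hinj
    have hu : IsUnit (f ^ n) := (Module.End.isUnit_iff _).2 hb
    exact (isUnit_pow_iff (by omega)).1 hu
  · right
    exact ⟨n, LinearMap.range_eq_bot.1 h⟩

theorem unit_of_add_eq_one_aux {A M : Type*} [Ring A] [AddCommGroup M] [Module A M]
    [IsArtinian A M] [IsNoetherian A M]
    (hM : ∀ X Y : Submodule A M, IsCompl X Y → X = ⊥ ∨ Y = ⊥) (f g : Module.End A M)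
    (h : f + g = 1) : IsUnit f ∨ IsUnit g := by
  rcases fitting_aux hM f with hf | hf
  · exact Or.inl hf
  · right
    have : g = 1 - f := by rw [← h]; abel
    rw [this]
    exact hf.isUnit_one_sub

/-- If `N → M → N` is bijective and `M` is indecomposable, `N ≠ 0`, then `N ≃ M`. -/
theorem equiv_of_unit_aux {A M N : Type*} [Ring A] [AddCommGroup M] [Module A M]
    [AddCommGroup N] [Module A N] [Nontrivial N]
    (hM : ∀ X Y : Submodule A M, IsCompl X Y → X = ⊥ ∨ Y = ⊥)
    (i : N →ₗ[A] M) (p : M →ₗ[A] N) (h : Function.Bijective (p ∘ₗ i)) :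
    Nonempty (N ≃ₗ[A] M) := by
  have hi : Function.Injective i := fun x y hxy => h.1 (by simp [hxy])
  have hc : IsCompl (LinearMap.range i) (LinearMap.ker p) := by
    constructor
    · rw [Submodule.disjoint_def]
      rintro _ ⟨x, rfl⟩ hx
      have : (p ∘ₗ i) x = (p ∘ₗ i) 0 := by simpa using hx
      rw [h.1 this, map_zero]
    · rw [codisjoint_iff, eq_top_iff]
      intro y _
      obtain ⟨x, hx⟩ := h.2 (p y)
      have hx' : p (i x) = p y := hx
      rw [show y = i x + (y - i x) by abel]
      exact Submodule.add_mem_sup ⟨x, rfl⟩ (by simp [hx'])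
  rcases hM _ _ hc with h0 | h0
  · exfalso
    obtain ⟨x, hx⟩ := exists_ne (0 : N)
    have : i x = 0 := by
      have := LinearMap.mem_range_self i x
      rw [h0] at this
      simpa using this
    exact hx (hi (by simpa using this))
  · refine ⟨LinearEquiv.ofBijective i ⟨hi, ?_⟩⟩
    rw [← LinearMap.range_eq_top]
    have := hc.sup_eq_top
    rwa [h0, sup_bot_eq] at this

/-- Extraction of a projective cover as a direct summand. -/
theorem exists_idem_aux {A Q M : Type*} [Ring A] [AddCommGroup Q] [Module A Q]
    [AddCommGroup M] [Module A M] [IsArtinian A Q] [IsNoetherian A Q] [Module.Projective A Q]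
    (f : Q →ₗ[A] M) (hf : Function.Surjective f) :
    ∃ (N : Submodule A Q) (e : Q →ₗ[A] N), (∀ x : N, e x = x) ∧ (∀ x, f (e x) = f x) ∧
      ∀ N' : Submodule A N, N' ⊔ LinearMap.ker (f ∘ₗ N.subtype) = ⊤ → N' = ⊤ := by
  obtain ⟨N, hN, hmin⟩ := IsArtinian.set_has_minimal
    {N : Submodule A Q | Function.Surjective (f ∘ₗ N.subtype)}
    ⟨⊤, fun y => by obtain ⟨x, hx⟩ := hf y; exact ⟨⟨x, trivial⟩, hx⟩⟩
  have hN : Function.Surjective (f ∘ₗ N.subtype) := hN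
  have key : ∀ N' : Submodule A N, Function.Surjective (f ∘ₗ N.subtype ∘ₗ N'.subtype) →
      N' = ⊤ := by
    intro N' hN'
    have h1 : N'.map N.subtype ≤ N := Submodule.map_subtype_le N N'
    have h2 : N'.map N.subtype ∈ {N : Submodule A Q | Function.Surjective (f ∘ₗ N.subtype)} := by
      intro y
      obtain ⟨x, hx⟩ := hN' y
      exact ⟨⟨x.1.1, ⟨x.1, x.2, rfl⟩⟩, hx⟩
    have h3 : N'.map N.subtype = N := by
      by_contra hne
      exact hmin _ h2 (lt_of_le_of_ne h1 hne)
    rw [eq_top_iff]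
    intro x _
    have : (x : Q) ∈ N'.map N.subtype := by rw [h3]; exact x.2
    obtain ⟨z, hz, hzx⟩ := this
    have : z = x := Subtype.ext hzx
    exact this ▸ hz
  obtain ⟨h, hh⟩ := Module.projective_lifting_property (f ∘ₗ N.subtype) f hN
  have hh' : ∀ x, f (h x) = f x := fun x => LinearMap.congr_fun hh x
  have hsurj : Function.Surjective (h ∘ₗ N.subtype) := by
    rw [← LinearMap.range_eq_top]
    apply key
    intro y
    obtain ⟨x, hx⟩ := hN y
    refine ⟨⟨h x, ⟨x, rfl⟩⟩, ?_⟩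
    simp only [LinearMap.comp_apply, Submodule.subtype_apply] at hx ⊢
    rw [hh', hx]
  have hbij : Function.Bijective (h ∘ₗ N.subtype) :=
    IsNoetherian.bijective_of_surjective_endomorphism _ hsurj
  let E := LinearEquiv.ofBijective _ hbij
  have hE : ∀ x : N, E x = h x := fun x => rfl
  refine ⟨N, E.symm.toLinearMap ∘ₗ h, ?_, ?_, ?_⟩
  · intro x
    simp [← hE]
  · intro x
    have : h (E.symm (h x) : N) = h x := by rw [← hE]; simp
    simp only [LinearMap.comp_apply, LinearEquiv.coe_coe]
    rw [← hh', this, hh']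
  · intro N' hN'
    apply key
    intro y
    obtain ⟨x, hx⟩ := hN y
    have : x ∈ N' ⊔ LinearMap.ker (f ∘ₗ N.subtype) := by rw [hN']; trivial
    obtain ⟨a, ha, b, hb, rfl⟩ := Submodule.mem_sup.1 this
    refine ⟨⟨a, ha⟩, ?_⟩
    rw [map_add, LinearMap.mem_ker.1 hb, add_zero] at hx
    exact hx

theorem ker_split_aux {A Q M : Type*} [Ring A] [AddCommGroup Q] [Module A Q]
    [AddCommGroup M] [Module A M] [Module.Projective A Q]
    (f : Q →ₗ[A] M) (N : Submodule A Q) (e : Q →ₗ[A] N) (he : ∀ x : N, e x = x)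
    (hfe : ∀ x, f (e x) = f x) :
    ∃ C : Submodule A (LinearMap.ker f),
      Nonempty (LinearMap.ker f ≃ₗ[A] (C × LinearMap.ker (f ∘ₗ N.subtype))) ∧
      Module.Projective A C := by
  let g : LinearMap.ker f →ₗ[A] LinearMap.ker (f ∘ₗ N.subtype) :=
    (e ∘ₗ (LinearMap.ker f).subtype).codRestrict _ (fun x => by
      rw [LinearMap.mem_ker]
      exact (hfe x.1).trans x.2)
  let s : LinearMap.ker (f ∘ₗ N.subtype) →ₗ[A] LinearMap.ker f :=
    (N.subtype ∘ₗ (LinearMap.ker (f ∘ₗ N.subtype)).subtype).codRestrict _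
      (fun x => x.2)
  have hgs : ∀ x, g (s x) = x := by
    intro x
    apply Subtype.ext
    exact he x.1
  refine ⟨LinearMap.ker g, ⟨splitEquivAux g s hgs⟩, ?_⟩
  let r : Q →ₗ[A] LinearMap.ker f :=
    (LinearMap.id - N.subtype ∘ₗ e).codRestrict _ (fun x => by simp [hfe])
  let r' : Q →ₗ[A] LinearMap.ker g := r.codRestrict _ (fun x => by
    rw [LinearMap.mem_ker]
    apply Subtype.ext
    show e (x - (e x : Q)) = 0
    rw [map_sub, he, sub_self])
  refine Module.Projective.of_split
    ((LinearMap.ker f).subtype ∘ₗ (LinearMap.ker g).subtype) r' ?_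
  ext x
  have hx : e (x.1.1) = 0 := congrArg Subtype.val x.2
  show (x.1.1 : Q) - (e x.1.1 : Q) = x.1.1
  rw [hx]
  simp

theorem summand_aux {A M N : Type*} [Ring A] [AddCommGroup M] [Module A M]
    [AddCommGroup N] [Module A N] (X Y : Submodule A M) (h : IsCompl X Y) (e : N ≃ₗ[A] X) :
    ∃ (i : N →ₗ[A] M) (r : M →ₗ[A] N), ∀ x, r (i x) = x :=
  ⟨X.subtype ∘ₗ e.toLinearMap, e.symm.toLinearMap ∘ₗ X.projectionOnto Y h, fun x => by simp⟩

/-- Sum of the images of maps from `S`. -/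
def trAux (A S M : Type*) [Ring A] [AddCommGroup S] [Module A S] [AddCommGroup M] [Module A M] :
    Submodule A M := ⨆ f : S →ₗ[A] M, LinearMap.range f

/-- Elements in the trace of `S` killed by all maps to `S`. -/
def rjAux (A S M : Type*) [Ring A] [AddCommGroup S] [Module A S] [AddCommGroup M] [Module A M] :
    Submodule A M := trAux A S M ⊓ ⨅ g : M →ₗ[A] S, LinearMap.ker g

theorem mem_rjAux {A S M : Type*} [Ring A] [AddCommGroup S] [Module A S] [AddCommGroup M]
    [Module A M] (x : M) : x ∈ rjAux A S M ↔ x ∈ trAux A S M ∧ ∀ g : M →ₗ[A] S, g x = 0 := by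
  simp [rjAux]

theorem map_trAux {A S M N : Type*} [Ring A] [AddCommGroup S] [Module A S] [AddCommGroup M]
    [Module A M] [AddCommGroup N] [Module A N] (h : M →ₗ[A] N) {x : M} (hx : x ∈ trAux A S M) :
    h x ∈ trAux A S N := by
  have : (trAux A S M).map h ≤ trAux A S N := by
    unfold trAux
    rw [Submodule.map_iSup]
    refine iSup_le fun f => ?_
    rw [← LinearMap.range_comp]
    exact le_iSup (fun f : S →ₗ[A] N => LinearMap.range f) (h ∘ₗ f)
  exact this ⟨x, hx, rfl⟩

theorem map_rjAux {A S M N : Type*} [Ring A] [AddCommGroup S] [Module A S] [AddCommGroup M]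
    [Module A M] [AddCommGroup N] [Module A N] (h : M →ₗ[A] N) {x : M} (hx : x ∈ rjAux A S M) :
    h x ∈ rjAux A S N := by
  rw [mem_rjAux] at *
  exact ⟨map_trAux h hx.1, fun g => hx.2 (g ∘ₗ h)⟩

/-- A functorial family of submodules has additive length: general helper. -/
def subProdAux {A X M N : Type*} [Ring A] [AddCommGroup X] [Module A X] [AddCommGroup M]
    [Module A M] [AddCommGroup N] [Module A N] (e : X ≃ₗ[A] (M × N))
    (TX : Submodule A X) (TM : Submodule A M) (TN : Submodule A N)
    (h1 : ∀ x ∈ TX, (e x).1 ∈ TM) (h2 : ∀ x ∈ TX, (e x).2 ∈ TN)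
    (h3 : ∀ x ∈ TM, e.symm (x, 0) ∈ TX) (h4 : ∀ x ∈ TN, e.symm (0, x) ∈ TX) :
    TX ≃ₗ[A] (TM × TN) where
  toFun x := (⟨(e x).1, h1 x x.2⟩, ⟨(e x).2, h2 x x.2⟩)
  invFun y := ⟨e.symm (y.1, y.2), by
    have : ((y.1 : M), (y.2 : N)) = ((y.1 : M), (0 : N)) + ((0 : M), (y.2 : N)) := by simp
    rw [this, map_add]
    exact add_mem (h3 _ y.1.2) (h4 _ y.2.2)⟩
  map_add' x y := by ext <;> simp
  map_smul' c x := by ext <;> simp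
  left_inv x := by ext; simp
  right_inv y := by ext <;> simp

/-- Multiplicity of `S` as a direct summand. -/
noncomputable def multAux (A S M : Type*) [Ring A] [AddCommGroup S] [Module A S] [AddCommGroup M]
    [Module A M] : ℤ :=
  ((Module.length A (trAux A S M)).toNat : ℤ) - ((Module.length A (rjAux A S M)).toNat : ℤ)

theorem multAux_prod {A S X M N : Type*} [Ring A] [AddCommGroup S] [Module A S]
    [AddCommGroup X] [Module A X] [AddCommGroup M]
    [Module A M] [AddCommGroup N] [Module A N] [IsArtinian A M] [IsNoetherian A M]
    [IsArtinian A N] [IsNoetherian A N] (e : X ≃ₗ[A] (M × N)) :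
    multAux A S X = multAux A S M + multAux A S N := by
  have E1 := subProdAux e (trAux A S X) (trAux A S M) (trAux A S N)
    (fun x hx => map_trAux (LinearMap.fst A M N ∘ₗ e.toLinearMap) hx)
    (fun x hx => map_trAux (LinearMap.snd A M N ∘ₗ e.toLinearMap) hx)
    (fun x hx => map_trAux (e.symm.toLinearMap ∘ₗ LinearMap.inl A M N) hx)
    (fun x hx => map_trAux (e.symm.toLinearMap ∘ₗ LinearMap.inr A M N) hx)
  have E2 := subProdAux e (rjAux A S X) (rjAux A S M) (rjAux A S N)
    (fun x hx => map_rjAux (LinearMap.fst A M N ∘ₗ e.toLinearMap) hx)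
    (fun x hx => map_rjAux (LinearMap.snd A M N ∘ₗ e.toLinearMap) hx)
    (fun x hx => map_rjAux (e.symm.toLinearMap ∘ₗ LinearMap.inl A M N) hx)
    (fun x hx => map_rjAux (e.symm.toLinearMap ∘ₗ LinearMap.inr A M N) hx)
  unfold multAux
  rw [E1.length_eq, E2.length_eq, Module.length_prod, Module.length_prod,
    ENat.toNat_add Module.length_ne_top Module.length_ne_top,
    ENat.toNat_add Module.length_ne_top Module.length_ne_top]
  push_cast
  ring

theorem multAux_self {A S : Type*} [Ring A] [AddCommGroup S] [Module A S] [IsSimpleModule A S] :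
    multAux A S S = 1 := by
  have h1 : trAux A S S = ⊤ := by
    rw [eq_top_iff]
    intro x _
    exact le_iSup (fun f : S →ₗ[A] S => LinearMap.range f) LinearMap.id ⟨x, rfl⟩
  have h2 : rjAux A S S = ⊥ := by
    rw [eq_bot_iff]
    intro x hx
    exact ((mem_rjAux x).1 hx).2 LinearMap.id
  unfold multAux
  rw [h1, h2]
  simp [Module.length_eq_one]

theorem multAux_proj {A S Q : Type*} [Ring A] [AddCommGroup S] [Module A S] [IsSimpleModule A S]
    [AddCommGroup Q] [Module A Q] [Module.Projective A Q] (hS : ¬ Module.Projective A S) :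
    multAux A S Q = 0 := by
  have : rjAux A S Q = trAux A S Q := by
    unfold rjAux
    rw [inf_eq_left]
    refine iSup_le fun f => le_iInf fun g => ?_
    rintro _ ⟨x, rfl⟩
    by_contra hne
    apply hS
    have hne0 : g ∘ₗ f ≠ 0 := fun h0 => hne (LinearMap.congr_fun h0 x)
    let E := LinearEquiv.ofBijective _ (LinearMap.bijective_of_ne_zero hne0)
    refine Module.Projective.of_split f (E.symm.toLinearMap ∘ₗ g) ?_
    ext y
    exact E.symm_apply_apply y
  unfold multAux
  rw [this, sub_self]

end Aux

section ITAux

variable {R}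

theorem cls_prod_aux (A B C : FGMod R) (e : A ≃ₗ[Rᵐᵒᵖ] (B × C : Type u)) :
    ITcls R A = ITcls R B + ITcls R C := by
  have h : FreeAbelianGroup.of A - FreeAbelianGroup.of B - FreeAbelianGroup.of C ∈
      AddSubgroup.closure (ITRel R) :=
    AddSubgroup.subset_closure (Or.inl ⟨A, B, C, ⟨e⟩, rfl⟩)
  have h0 := (QuotientAddGroup.eq_zero_iff _).2 h
  have h1 : ITcls R A - ITcls R B - ITcls R C = 0 := h0
  rw [sub_sub, sub_eq_zero] at h1
  exact h1

theorem cls_proj_aux (A : FGMod R) (hA : A.Proj) : ITcls R A = 0 := by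
  have h : FreeAbelianGroup.of A ∈ AddSubgroup.closure (ITRel R) :=
    AddSubgroup.subset_closure (Or.inr ⟨A, hA, rfl⟩)
  exact (QuotientAddGroup.eq_zero_iff _).2 h

theorem cls_iso_aux (A B : FGMod R) (e : A ≃ₗ[Rᵐᵒᵖ] B) : ITcls R A = ITcls R B := by
  have hz : (⟨PUnit.{u+1}⟩ : FGMod R).Proj := by
    show Module.Projective Rᵐᵒᵖ PUnit.{u+1}
    infer_instance
  have := cls_prod_aux A B ⟨PUnit.{u+1}⟩ (e.trans (LinearEquiv.prodUnique (R := Rᵐᵒᵖ) (M₂ := PUnit.{u+1})).symm)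
  rw [this, cls_proj_aux _ hz, add_zero]

theorem exists_fg_aux (M : Type u) [AddCommGroup M] [Module Rᵐᵒᵖ M] [Module.Finite Rᵐᵒᵖ M] :
    ∃ L : FGMod R, Nonempty (L ≃ₗ[Rᵐᵒᵖ] M) := ⟨⟨M⟩, ⟨LinearEquiv.refl _ _⟩⟩

theorem omk_eq_aux [IsArtinianRing Rᵐᵒᵖ] (OmK : AddMonoid.End (ITK R)) (hOm : IsSyzygyEnd R OmK)
    (Q M K : FGMod R) (hQ : Q.Proj) (f : Q →ₗ[Rᵐᵒᵖ] M) (hf : Function.Surjective f)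
    (eK : K ≃ₗ[Rᵐᵒᵖ] LinearMap.ker f) : OmK (ITcls R M) = ITcls R K := by
  have hQ' : Module.Projective Rᵐᵒᵖ Q := hQ
  obtain ⟨N, e, he, hfe, hcov⟩ := exists_idem_aux f hf
  have hNp : Module.Projective Rᵐᵒᵖ N :=
    Module.Projective.of_split N.subtype e (by ext x; simp [he])
  obtain ⟨L, ⟨eL⟩⟩ := exists_fg_aux (R := R) (LinearMap.ker (f ∘ₗ N.subtype))
  have hsyz : IsSyzygy M L := by
    refine ⟨⟨N⟩, f ∘ₗ N.subtype, ⟨hNp, ?_, hcov⟩, ⟨eL⟩⟩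
    intro y
    obtain ⟨x, hx⟩ := hf y
    exact ⟨e x, (hfe x).trans hx⟩
  rw [hOm M L hsyz]
  obtain ⟨D, ⟨eD⟩, hD⟩ := ker_split_aux f N e he hfe
  obtain ⟨C, ⟨eC⟩⟩ := exists_fg_aux (R := R) D
  have hC : C.Proj := Module.Projective.of_equiv eC.symm
  have E : K ≃ₗ[Rᵐᵒᵖ] (C × L : Type u) :=
    (eK.trans eD).trans ((eC.symm.prodCongr eL.symm))
  rw [cls_prod_aux K C L E, cls_proj_aux C hC, zero_add]

/-- Multiplicity of `S` as a homomorphism on `K`. -/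
theorem exists_mult_aux [IsArtinianRing Rᵐᵒᵖ] (S : FGMod R) [IsSimpleModule Rᵐᵒᵖ S]
    (hS : ¬ S.Proj) : ∃ mu : ITK R →+ ℤ, mu (ITcls R S) = 1 := by
  let mu0 : FreeAbelianGroup (FGMod R) →+ ℤ :=
    FreeAbelianGroup.lift (fun M : FGMod R => multAux Rᵐᵒᵖ S M)
  have h : AddSubgroup.closure (ITRel R) ≤ mu0.ker := by
    rw [AddSubgroup.closure_le]
    rintro x (⟨A, B, C, ⟨e⟩, rfl⟩ | ⟨Q, hQ, rfl⟩)
    · have := multAux_prod (S := S) e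
      simp [mu0, AddMonoidHom.mem_ker, this]
    · have hQ' : Module.Projective Rᵐᵒᵖ Q := hQ
      have := multAux_proj (A := Rᵐᵒᵖ) (S := S) (Q := Q) hS
      simp [mu0, AddMonoidHom.mem_ker, this]
  refine ⟨QuotientAddGroup.lift _ mu0 h, ?_⟩
  show mu0 (FreeAbelianGroup.of S) = 1
  simp [mu0, multAux_self]

theorem gen_eq_aux [IsArtinianRing Rᵐᵒᵖ] (S : FGMod R) [IsSimpleModule Rᵐᵒᵖ S]
    (hS : ¬ S.Proj) : ITgen R S = AddSubgroup.closure {ITcls R S} := by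
  apply le_antisymm
  · unfold ITgen
    rw [AddSubgroup.closure_le]
    rintro x ⟨N, ⟨A, B, hAB, ⟨e⟩⟩, hN, -, rfl⟩
    rcases eq_bot_or_eq_top A with h | h
    · subst h
      have := hN.1
      exact (not_nontrivial _ e.symm.toEquiv.nontrivial).elim
    · subst h
      rw [cls_iso_aux N S (e.trans Submodule.topEquiv)]
      exact AddSubgroup.subset_closure rfl
  · rw [AddSubgroup.closure_le]
    rintro _ rfl
    refine AddSubgroup.subset_closure ⟨S, ⟨⊤, ⊥, isCompl_top_bot, ⟨Submodule.topEquiv.symm⟩⟩,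
      ⟨IsSimpleModule.nontrivial Rᵐᵒᵖ S, fun A B hAB => ?_⟩, hS, rfl⟩
    rcases eq_bot_or_eq_top A with h | h
    · exact Or.inl h
    · right
      have := hAB.inf_eq_bot
      rwa [h, top_inf_eq] at this

theorem omk_ne_zero_aux [IsArtinianRing Rᵐᵒᵖ] (OmK : AddMonoid.End (ITK R))
    (S : FGMod R) [IsSimpleModule Rᵐᵒᵖ S] (hS : ¬ S.Proj) (hphi : phiIT R OmK S = 0) :
    OmK (ITcls R S) ≠ 0 := by
  intro h0
  obtain ⟨mu, hmu⟩ := exists_mult_aux S hS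
  have hgen := gen_eq_aux S hS
  have hmap : ∀ i, 1 ≤ i →
      (ITgen R S).map ((OmK ^ i : AddMonoid.End (ITK R)) : ITK R →+ ITK R) = ⊥ := by
    intro i hi
    obtain ⟨k, rfl⟩ := Nat.exists_eq_add_of_le' hi
    rw [hgen, eq_bot_iff]
    refine AddSubgroup.map_le_iff_le_comap.2 ((AddSubgroup.closure_le _).2 ?_)
    rintro _ rfl
    show (OmK ^ (k + 1)) (ITcls R S) = 0
    rw [pow_succ]
    show (OmK ^ k) (OmK (ITcls R S)) = 0
    rw [h0, map_zero]
  have hne : {n | ∀ i, n ≤ i →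
    rkIT R ((ITgen R S).map ((OmK ^ i : AddMonoid.End (ITK R)) : ITK R →+ ITK R))
      = rkIT R ((ITgen R S).map ((OmK ^ n : AddMonoid.End (ITK R)) : ITK R →+ ITK R))}.Nonempty :=
    ⟨1, fun i hi => by rw [hmap i hi, hmap 1 le_rfl]⟩
  have hmem := Nat.sInf_mem hne
  unfold phiIT at hphi
  rw [hphi] at hmem
  have h1 := hmem 1 (by norm_num)
  rw [hmap 1 le_rfl] at h1
  have hid : (ITgen R S).map ((OmK ^ 0 : AddMonoid.End (ITK R)) : ITK R →+ ITK R) = ITgen R S := by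
    rw [pow_zero]
    exact AddSubgroup.map_id _
  rw [hid] at h1
  unfold rkIT at h1
  have hbot : Module.finrank ℤ (AddSubgroup.toIntSubmodule (⊥ : AddSubgroup (ITK R))) = 0 := by
    rw [map_bot]
    exact finrank_bot ℤ (ITK R)
  rw [hbot] at h1
  have hx : AddSubgroup.toIntSubmodule (ITgen R S) = Submodule.span ℤ {ITcls R S} := by
    rw [hgen]
    exact AddSubgroup.toIntSubmodule_closure _
  rw [hx] at h1
  have hinj : Function.Injective (LinearMap.toSpanSingleton ℤ (ITK R) (ITcls R S)) := by
    intro a b hab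
    have := congrArg mu hab
    simpa [hmu] using this
  have e1 := LinearEquiv.ofInjective _ hinj
  have h2 := e1.finrank_eq
  rw [LinearMap.range_toSpanSingleton, ← h1] at h2
  simp at h2

theorem core_aux [IsArtinianRing Rᵐᵒᵖ]
    (OmK : AddMonoid.End (ITK R)) (hOm : IsSyzygyEnd R OmK)
    (hphi : ∀ N : FGMod R, phiIT R OmK N = 0)
    (P : FGMod R) (hind : P.Indec) (hproj : P.Proj)
    (hsoc : IsSimpleModule Rᵐᵒᵖ (socleIT R P))
    (U S : FGMod R) [IsSimpleModule Rᵐᵒᵖ S]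
    (j : P →ₗ[Rᵐᵒᵖ] U) (hj : Function.Injective j)
    (hess : ∀ Q : Submodule Rᵐᵒᵖ U, Q ⊓ LinearMap.range j = ⊥ → Q = ⊥)
    (p : U →ₗ[Rᵐᵒᵖ] S) (hp : Function.Surjective p) (hk : LinearMap.ker p = LinearMap.range j) :
    U.Indec ∧ IsSimpleModule Rᵐᵒᵖ (socleIT R U) ∧ ¬ S.Proj ∧ ¬ U.Proj ∧
        OmK (ITcls R U) = OmK (ITcls R S) ∧
        AddSubgroup.map (OmK : ITK R →+ ITK R) (ITgen R (U.prod S)) =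
          AddSubgroup.map (OmK : ITK R →+ ITK R) (ITgen R S) := by
  have hPn : Nontrivial P := hind.1
  have hSn : Nontrivial S := IsSimpleModule.nontrivial Rᵐᵒᵖ S
  have hproj' : Module.Projective Rᵐᵒᵖ P := hproj
  have hUn : Nontrivial U := hj.nontrivial
  -- every simple submodule of U is the image of the socle of P
  have hsimple : ∀ X : Submodule Rᵐᵒᵖ U, IsSimpleModule Rᵐᵒᵖ X → X = (socleIT R P).map j := by
    intro X hX
    have hXa : IsAtom X := isSimpleModule_iff_isAtom.1 hX
    have hle : X ≤ LinearMap.range j := by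
      by_contra hnle
      have : X ⊓ LinearMap.range j = ⊥ := by
        rcases hXa.le_iff.1 (inf_le_left : X ⊓ LinearMap.range j ≤ X) with h | h
        · exact h
        · exact absurd (inf_eq_left.1 h) hnle
      exact hXa.1 (hess X this)
    have hmap : (X.comap j).map j = X := by
      rw [Submodule.map_comap_eq, inf_eq_right.2 hle]
    have hYs : IsSimpleModule Rᵐᵒᵖ (X.comap j) := by
      have e1 := Submodule.equivMapOfInjective j hj (X.comap j)
      rw [hmap] at e1
      exact IsSimpleModule.congr e1
    have hYle : X.comap j ≤ socleIT R P := le_sSup hYs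
    have hsa : IsAtom (socleIT R P) := isSimpleModule_iff_isAtom.1 hsoc
    have : X.comap j = socleIT R P := by
      rcases hsa.le_iff.1 hYle with h | h
      · exact absurd h (isSimpleModule_iff_isAtom.1 hYs).1
      · exact h
    rw [← this, hmap]
  have hTs : IsSimpleModule Rᵐᵒᵖ ((socleIT R P).map j) :=
    IsSimpleModule.congr (Submodule.equivMapOfInjective j hj (socleIT R P)).symm
  have hsocU : socleIT R U = (socleIT R P).map j := by
    apply le_antisymm
    · exact sSup_le fun X hX => (hsimple X hX).le
    · exact le_sSup hTs
  have hsocUs : IsSimpleModule Rᵐᵒᵖ (socleIT R U) := by rw [hsocU]; exact hTs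
  have hTa := isSimpleModule_iff_isAtom.1 hTs
  have hge : ∀ X : Submodule Rᵐᵒᵖ U, X ≠ ⊥ → (socleIT R P).map j ≤ X := by
    intro X hX
    obtain ⟨Y, hY, hYX⟩ := (IsAtomic.eq_bot_or_exists_atom_le X).resolve_left hX
    rw [← hsimple Y (isSimpleModule_iff_isAtom.2 hY)]
    exact hYX
  have hUind : U.Indec := by
    refine ⟨hUn, fun A B hAB => ?_⟩
    by_contra! hne
    have := le_inf (hge A hne.1) (hge B hne.2)
    rw [hAB.inf_eq_bot, le_bot_iff] at this
    exact hTa.1 this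
  have hSind : S.Indec := by
    refine ⟨hSn, fun A B hAB => ?_⟩
    rcases eq_bot_or_eq_top A with h | h
    · exact Or.inl h
    · right
      have := hAB.inf_eq_bot
      rwa [h, top_inf_eq] at this
  have hSnp : ¬ S.Proj := by
    intro hSp
    have hSp' : Module.Projective Rᵐᵒᵖ S := hSp
    obtain ⟨s, hs⟩ := Module.projective_lifting_property p LinearMap.id hp
    have hbij : Function.Bijective (p ∘ₗ s) := by rw [hs]; exact Function.bijective_id
    obtain ⟨E⟩ := equiv_of_unit_aux hUind.2 s p hbij
    have hUs : IsSimpleModule Rᵐᵒᵖ U := IsSimpleModule.congr E.symm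
    have hpinj : Function.Injective p := by
      refine LinearMap.injective_of_ne_zero ?_
      rintro rfl
      obtain ⟨y, hy⟩ := exists_ne (0 : S)
      obtain ⟨x, hx⟩ := hp y
      exact hy (by simpa using hx.symm)
    have hb := LinearMap.ker_eq_bot.2 hpinj
    rw [hk, LinearMap.range_eq_bot] at hb
    obtain ⟨x, hx⟩ := exists_ne (0 : P)
    exact hx (hj (by simp [hb]))
  have hUnp : ¬ U.Proj := by
    intro hUp
    refine omk_ne_zero_aux OmK S hSnp (hphi S) ?_
    rw [omk_eq_aux OmK hOm U S P hUp p hp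
      ((LinearEquiv.ofInjective j hj).trans (LinearEquiv.ofEq _ _ hk.symm))]
    exact cls_proj_aux P hproj
  have homk : OmK (ITcls R U) = OmK (ITcls R S) := by
    obtain ⟨n, q, hq⟩ := Module.Finite.exists_fin' Rᵐᵒᵖ U
    let Q : FGMod R := ⟨Fin n → Rᵐᵒᵖ⟩
    have hQ : Q.Proj := by
      show Module.Projective Rᵐᵒᵖ (Fin n → Rᵐᵒᵖ)
      infer_instance
    let K1 : FGMod R := ⟨LinearMap.ker q⟩
    let K2 : FGMod R := ⟨LinearMap.ker (p ∘ₗ q)⟩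
    have h1 := omk_eq_aux OmK hOm Q U K1 hQ q hq (LinearEquiv.refl _ _)
    have h2 := omk_eq_aux OmK hOm Q S K2 hQ (p ∘ₗ q) (hp.comp hq) (LinearEquiv.refl _ _)
    rw [h1, h2]
    let jE : LinearMap.ker p ≃ₗ[Rᵐᵒᵖ] P :=
      ((LinearEquiv.ofInjective j hj).trans (LinearEquiv.ofEq _ _ hk.symm)).symm
    let g0 : LinearMap.ker (p ∘ₗ q) →ₗ[Rᵐᵒᵖ] LinearMap.ker p :=
      (q ∘ₗ (LinearMap.ker (p ∘ₗ q)).subtype).codRestrict _ (fun x => x.2)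
    let g : LinearMap.ker (p ∘ₗ q) →ₗ[Rᵐᵒᵖ] P := jE.toLinearMap ∘ₗ g0
    have hg0 : Function.Surjective g0 := by
      intro y
      obtain ⟨x, hx⟩ := hq y.1
      refine ⟨⟨x, ?_⟩, Subtype.ext hx⟩
      rw [LinearMap.mem_ker, LinearMap.comp_apply, hx]
      exact y.2
    have hg : Function.Surjective g := jE.surjective.comp hg0
    obtain ⟨s, hs⟩ := Module.projective_lifting_property g LinearMap.id hg
    have e1 := splitEquivAux g s (fun x => LinearMap.congr_fun hs x)
    have hmem : ∀ x : LinearMap.ker (p ∘ₗ q), g x = 0 ↔ q x = 0 := by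
      intro x
      show jE (g0 x) = 0 ↔ q x = 0
      rw [LinearEquiv.map_eq_zero_iff]
      exact Subtype.ext_iff
    let e2 : LinearMap.ker g ≃ₗ[Rᵐᵒᵖ] LinearMap.ker q :=
      { toFun := fun x => ⟨x.1.1, (hmem x.1).1 x.2⟩
        invFun := fun x => ⟨⟨x.1, by
          rw [LinearMap.mem_ker, LinearMap.comp_apply, LinearMap.mem_ker.1 x.2, map_zero]⟩,
          (hmem _).2 x.2⟩
        map_add' := fun x y => rfl
        map_smul' := fun c x => rfl
        left_inv := fun x => rfl
        right_inv := fun x => rfl }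
    rw [cls_prod_aux K2 K1 P (e1.trans (e2.prodCongr (LinearEquiv.refl _ _))),
      cls_proj_aux P hproj, add_zero]
  refine ⟨hUind, hsocUs, hSnp, hUnp, homk, ?_⟩
  rw [gen_eq_aux S hSnp]
  apply le_antisymm
  · refine AddSubgroup.map_le_iff_le_comap.2 ((AddSubgroup.closure_le _).2 ?_)
    rintro x ⟨N, ⟨A, B, hAB, ⟨e⟩⟩, hN, -, rfl⟩
    have hNn : Nontrivial N := hN.1
    have hmem : OmK (ITcls R S) ∈
        AddSubgroup.map (OmK : ITK R →+ ITK R) (AddSubgroup.closure {ITcls R S}) :=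
      ⟨_, AddSubgroup.subset_closure rfl, rfl⟩
    show OmK (ITcls R N) ∈
        AddSubgroup.map (OmK : ITK R →+ ITK R) (AddSubgroup.closure {ITcls R S})
    obtain ⟨i, r, hri⟩ : ∃ (i : N →ₗ[Rᵐᵒᵖ] (U × S : Type u)) (r : (U × S : Type u) →ₗ[Rᵐᵒᵖ] N),
        ∀ x, r (i x) = x := summand_aux A B hAB e
    let iU := LinearMap.fst Rᵐᵒᵖ U S ∘ₗ i
    let iS := LinearMap.snd Rᵐᵒᵖ U S ∘ₗ i
    let rU := r ∘ₗ LinearMap.inl Rᵐᵒᵖ U S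
    let rS := r ∘ₗ LinearMap.inr Rᵐᵒᵖ U S
    have hsum : (rU ∘ₗ iU : Module.End Rᵐᵒᵖ N) + (rS ∘ₗ iS : Module.End Rᵐᵒᵖ N) = 1 := by
      ext x
      show r ((i x).1, 0) + r (0, (i x).2) = x
      rw [← map_add]
      simpa using hri x
    rcases unit_of_add_eq_one_aux hN.2 _ _ hsum with h | h
    · obtain ⟨E⟩ := equiv_of_unit_aux hUind.2 iU rU ((Module.End.isUnit_iff _).1 h)
      rw [cls_iso_aux N U E, homk]
      exact hmem
    · obtain ⟨E⟩ := equiv_of_unit_aux hSind.2 iS rS ((Module.End.isUnit_iff _).1 h)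
      rw [cls_iso_aux N S E]
      exact hmem
  · apply AddSubgroup.map_mono
    rw [AddSubgroup.closure_le]
    rintro _ rfl
    refine AddSubgroup.subset_closure ⟨S, ⟨LinearMap.range (LinearMap.inr Rᵐᵒᵖ U S),
      LinearMap.range (LinearMap.inl Rᵐᵒᵖ U S), LinearMap.isCompl_range_inl_inr.symm,
      ⟨LinearEquiv.ofInjective _ LinearMap.inr_injective⟩⟩, hSind, hSnp, rfl⟩

end ITAux

/-- Let `P` be an indecomposable non-injective projective with simple
socle, `I ⊇ P` an injective hull, `S` a simple submodule of `I/P` and `U ⊆ I` the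
pullback of `S` along `I → I/P`. If `φ ≡ 0`, then `U` is finitely generated,
indecomposable with simple socle, `S` and `U` are non-projective, `[ΩU] = [ΩS]` in `K`,
and `Ω⟨U ⊕ S⟩ = Ω⟨S⟩`. -/
theorem pullback_syzygy_classes (R : Type u) [Ring R] [IsArtinianRing Rᵐᵒᵖ]
    (OmK : AddMonoid.End (ITK R)) (hOm : IsSyzygyEnd R OmK)
    (hphi : ∀ N : FGMod R, phiIT R OmK N = 0)
    (P : FGMod R) (hind : P.Indec) (hproj : P.Proj)
    (hsoc : IsSimpleModule Rᵐᵒᵖ (socleIT R P))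
    (hninj : ¬ Module.Injective Rᵐᵒᵖ P)
    (I : Type u) [AddCommGroup I] [Module Rᵐᵒᵖ I] (hI : Module.Injective Rᵐᵒᵖ I)
    (ι : P →ₗ[Rᵐᵒᵖ] I) (hι : Function.Injective ι)
    (hess : ∀ Q : Submodule Rᵐᵒᵖ I, Q ⊓ LinearMap.range ι = ⊥ → Q = ⊥)
    (S : Submodule Rᵐᵒᵖ (I ⧸ LinearMap.range ι)) (hS : IsSimpleModule Rᵐᵒᵖ S)
    (U : Submodule Rᵐᵒᵖ I) (hPU : LinearMap.range ι ≤ U)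
    (hU : U.map (LinearMap.range ι).mkQ = S) :
    Module.Finite Rᵐᵒᵖ U ∧
    (∀ MU MS : FGMod R,
      Nonempty (MU ≃ₗ[Rᵐᵒᵖ] U) → Nonempty (MS ≃ₗ[Rᵐᵒᵖ] S) →
      MU.Indec ∧ IsSimpleModule Rᵐᵒᵖ (socleIT R MU) ∧ ¬ MS.Proj ∧ ¬ MU.Proj ∧
        OmK (ITcls R MU) = OmK (ITcls R MS) ∧
        AddSubgroup.map (OmK : ITK R →+ ITK R) (ITgen R (MU.prod MS)) =
          AddSubgroup.map (OmK : ITK R →+ ITK R) (ITgen R MS)) := by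
  have hkey : ∀ x : U, (LinearMap.range ι).mkQ x ∈ S := fun x => by
    rw [← hU]
    exact ⟨x, x.2, rfl⟩
  let j0 : P →ₗ[Rᵐᵒᵖ] U := ι.codRestrict U (fun x => hPU ⟨x, rfl⟩)
  let p0 : U →ₗ[Rᵐᵒᵖ] S := ((LinearMap.range ι).mkQ ∘ₗ U.subtype).codRestrict S hkey
  have hj0 : Function.Injective j0 := fun x y hxy => hι (congrArg Subtype.val hxy)
  have hp0 : Function.Surjective p0 := by
    intro y
    have hy : (y : I ⧸ LinearMap.range ι) ∈ U.map (LinearMap.range ι).mkQ := by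
      rw [hU]; exact y.2
    obtain ⟨x, hx, hxy⟩ := hy
    exact ⟨⟨x, hx⟩, Subtype.ext hxy⟩
  have hk0 : ∀ x : U, p0 x = 0 ↔ (x : I) ∈ LinearMap.range ι := by
    intro x
    rw [← Submodule.Quotient.mk_eq_zero (LinearMap.range ι)]
    exact Subtype.ext_iff
  have hk0' : LinearMap.range j0 = LinearMap.ker p0 := by
    ext x
    rw [LinearMap.mem_ker, hk0]
    constructor
    · rintro ⟨y, rfl⟩
      exact ⟨y, rfl⟩
    · rintro ⟨y, hy⟩
      exact ⟨y, Subtype.ext hy⟩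
  have hnoeth : IsNoetherian Rᵐᵒᵖ U :=
    isNoetherian_of_range_eq_ker j0 p0 hk0'
  refine ⟨inferInstance, ?_⟩
  rintro MU MS ⟨eU⟩ ⟨eS⟩
  have hMS : IsSimpleModule Rᵐᵒᵖ MS := IsSimpleModule.congr eS
  refine core_aux OmK hOm hphi P hind hproj hsoc MU MS (eU.symm.toLinearMap ∘ₗ j0)
    (eU.symm.injective.comp hj0) ?_ (eS.symm.toLinearMap ∘ₗ p0 ∘ₗ eU.toLinearMap)
    (eS.symm.surjective.comp (hp0.comp eU.surjective)) ?_
  · intro Q hQ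
    have h1 : Q.map (U.subtype ∘ₗ eU.toLinearMap) = ⊥ := by
      apply hess
      rw [eq_bot_iff]
      rintro _ ⟨⟨x, hx, rfl⟩, ⟨y, hy⟩⟩
      have hxy : j0 y = eU x := Subtype.ext hy
      have : x ∈ Q ⊓ LinearMap.range (eU.symm.toLinearMap ∘ₗ j0) :=
        ⟨hx, ⟨y, by simp [hxy]⟩⟩
      rw [hQ] at this
      have hx0 : x = 0 := this
      simp [hx0]
    rw [eq_bot_iff]
    intro x hx
    have h2 : (eU x : I) ∈ Q.map (U.subtype ∘ₗ eU.toLinearMap) := ⟨x, hx, rfl⟩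
    rw [h1] at h2
    have h3 : eU x = 0 := Subtype.ext h2
    simpa using h3
  · ext x
    have h1 : x ∈ LinearMap.ker (eS.symm.toLinearMap ∘ₗ p0 ∘ₗ eU.toLinearMap) ↔
        eU x ∈ LinearMap.ker p0 := by
      simp
    rw [h1, ← hk0']
    constructor
    · rintro ⟨y, hy⟩
      exact ⟨y, by simp [hy]⟩
    · rintro ⟨y, hy⟩
      exact ⟨y, by rw [← hy]; simp⟩
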